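/- For every n ≥ 1, the set W_n of wheel polynomials of order n is a ℂ-linear subspace of ℂ[z_1,…,z_{2n}] whose dimension equals the Catalan number Cat(n) = (1/(n+1))·binom(2n, n). -/

import Mathlib

open scoped BigOperators

open MvPolynomial

attribute [local instance 10] Classical.propDecidable

/-- A noncrossing matching of order `n`, on the points `0, …, 2n-1`
(representing the 1-indexed points `1, …, 2n`): a fixed-point-free involution
with no crossing `a < b < c < d`, `f a = c`, `f b = d`. -/
structure NCM (n : ℕ) where
  f : Fin (2 * n) → Fin (2 * n)
  invol : ∀ k, f (f k) = k
  nofix : ∀ k, f k ≠ k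
  noncross : ∀ a b c d : Fin (2 * n), a < b → b < c → c < d → f a = c → f b = d → False

theorem NCM.ext' {n : ℕ} {π σ : NCM n} (h : π.f = σ.f) : π = σ := by
  cases π; cases σ; simpa using h

noncomputable instance {n : ℕ} : Fintype (NCM n) :=
  Fintype.ofInjective NCM.f fun _ _ h => NCM.ext' h

/-- `q = e^{2πi/3}`. -/
noncomputable def q : ℂ := Complex.exp (2 * Real.pi * Complex.I / 3)

/-- A wheel polynomial of order `n`: homogeneous of total degree `n(n-1)` and
vanishing under every substitution `z_j := q² z_i`, `z_k := q⁴ z_i` for `i < j < k`. -/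
def IsWheel (n : ℕ) (p : MvPolynomial (Fin (2 * n)) ℂ) : Prop :=
  p.IsHomogeneous (n * (n - 1)) ∧
  ∀ i j k : Fin (2 * n), i < j → j < k →
    (aeval fun l : Fin (2 * n) =>
      if l = j then C (q ^ 2) * X i
      else if l = k then C (q ^ 4) * X i
      else (X l : MvPolynomial (Fin (2 * n)) ℂ)) p = 0

/-- The `π`-evaluation `p(π) = p(q^{-π_1}, …, q^{-π_{2n}})`, where the `k`-th coordinate
is `q⁻¹` if `π` matches `k` to the right and `q` if it matches `k` to the left. -/
noncomputable def evalNC {n : ℕ} (p : MvPolynomial (Fin (2 * n)) ℂ) (π : NCM n) : ℂ :=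
  eval (fun k => if k < π.f k then q⁻¹ else q) p

/-- Evaluation of a polynomial with all variables set to `1`. -/
noncomputable def evalOne {n : ℕ} (p : MvPolynomial (Fin (2 * n)) ℂ) : ℂ :=
  eval (fun _ => (1 : ℂ)) p

/-- The alternating sign matrix numbers `ASM(n) = ∏_{j=0}^{n-1} (3j+1)!/(n+j)!`. -/
noncomputable def ASM (n : ℕ) : ℂ :=
  ∏ j ∈ Finset.range n, ((3 * j + 1).factorial : ℂ) / ((n + j).factorial : ℂ)

/-- Cyclic successor on `Fin m`. -/
def fsucc {m : ℕ} (k : Fin m) : Fin m := ⟨((k : ℕ) + 1) % m, Nat.mod_lt _ k.pos⟩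

/-- The Temperley–Lieb operator `e_k` (underlying function on points): if `π` matches
`k` with `k+1` it is `π`; otherwise it matches `k ↔ k+1`, `π(k) ↔ π(k+1)` and agrees
with `π` elsewhere (indices cyclic modulo `2n`). -/
def eRaw {n : ℕ} (k : Fin (2 * n)) (π : NCM n) : Fin (2 * n) → Fin (2 * n) :=
  if π.f k = fsucc k then π.f
  else fun m =>
    if m = k then fsucc k
    else if m = fsucc k then k
    else if m = π.f k then π.f (fsucc k)
    else if m = π.f (fsucc k) then π.f k
    else π.f m

/-- The stationarity linear system `2n·v_π = Σ_{k=1}^{2n} Σ_{π' : e_k(π') = π} v_{π'}`. -/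
def Stationary {n : ℕ} (v : NCM n → ℂ) : Prop :=
  ∀ π : NCM n, ((2 * n : ℕ) : ℂ) * v π =
    ∑ k : Fin (2 * n), ∑ π' : NCM n, if eRaw k π' = π.f then v π' else 0

/-! ### Facts about `q` -/

lemma q_pow_three : q ^ 3 = 1 := by
  unfold q
  rw [← Complex.exp_nat_mul]
  convert Complex.exp_two_pi_mul_I using 2
  push_cast
  ring

lemma q_prim : IsPrimitiveRoot q 3 := Complex.isPrimitiveRoot_exp 3 (by norm_num)

lemma q_ne_zero : q ≠ 0 := Complex.exp_ne_zero _

lemma q_ne_one : q ≠ 1 := q_prim.ne_one (by norm_num)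

lemma q_sq_ne_one : q ^ 2 ≠ 1 := q_prim.pow_ne_one_of_pos_of_lt (by norm_num) (by norm_num)

lemma q_sq_ne_q : q ^ 2 ≠ q := by
  intro h
  have : q * (q - 1) = 0 := by linear_combination h
  rcases mul_eq_zero.1 this with h | h
  · exact q_ne_zero h
  · exact q_ne_one (sub_eq_zero.1 h)

lemma q_pow_four : q ^ 4 = q := by linear_combination q * q_pow_three

/-! ### Linear substitutions -/

set_option linter.unusedSectionVars false

section General

variable {ι : Type} [LinearOrder ι]

/-- Substitute `r` for the variable `j`. -/
noncomputable def subst (j : ι) (r : MvPolynomial ι ℂ) :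
    MvPolynomial ι ℂ →ₐ[ℂ] MvPolynomial ι ℂ :=
  aeval fun l => if l = j then r else X l

lemma subst_self (j : ι) (r : MvPolynomial ι ℂ) : subst j r (X j) = r := by
  simp [subst]

lemma subst_of_ne {j l : ι} (r : MvPolynomial ι ℂ) (h : l ≠ j) : subst j r (X l) = X l := by
  simp [subst, h]

/-- The linear form `z_l - c z_i`. -/
noncomputable def lin (c : ℂ) (i l : ι) : MvPolynomial ι ℂ := X l - C c * X i

lemma subst_C (j : ι) (r : MvPolynomial ι ℂ) (c : ℂ) : subst j r (C c) = C c := by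
  rw [algHom_C]; rfl

lemma lin_dvd_iff {c : ℂ} {i l : ι} (h : l ≠ i) (p : MvPolynomial ι ℂ) :
    lin c i l ∣ p ↔ subst l (C c * X i) p = 0 := by
  constructor
  · rintro ⟨g, rfl⟩
    simp [lin, map_mul, map_sub, subst_self, subst_of_ne _ h.symm]
  · intro h0
    rw [← Ideal.mem_span_singleton, ← Ideal.Quotient.eq_zero_iff_mem]
    have : (Ideal.Quotient.mkₐ ℂ (Ideal.span {lin c i l})) =
        (Ideal.Quotient.mkₐ ℂ (Ideal.span {lin c i l})).comp (subst l (C c * X i)) := by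
      apply MvPolynomial.algHom_ext
      intro m
      by_cases hm : m = l
      · subst hm
        rw [AlgHom.comp_apply, subst_self]
        refine (Ideal.Quotient.mk_eq_mk_iff_sub_mem _ _).2 ?_
        exact Ideal.mem_span_singleton_self _
      · rw [AlgHom.comp_apply, subst_of_ne _ hm]
    have h2 := congrArg (fun f => f p) this
    simp only [AlgHom.comp_apply, h0, map_zero] at h2
    exact h2

lemma algHom_of_lin_dvd {A : Type*} [CommRing A] [Algebra ℂ A] {c : ℂ} {i l : ι}
    {p : MvPolynomial ι ℂ} (h : lin c i l ∣ p) (ψ : MvPolynomial ι ℂ →ₐ[ℂ] A)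
    (hψ : ψ (X l) = algebraMap ℂ A c * ψ (X i)) : ψ p = 0 := by
  obtain ⟨g, rfl⟩ := h
  simp [lin, map_mul, map_sub, hψ, algHom_C]

lemma lin_ne_zero {c : ℂ} {i l : ι} (h : l ≠ i) : lin c i l ≠ 0 := by
  intro h0
  have := congrArg (eval fun t => if t = l then (1 : ℂ) else 0) h0
  simp [lin, h.symm] at this

lemma lin_prime {c : ℂ} {i l : ι} (h : l ≠ i) : Prime (lin c i l) := by
  refine ⟨lin_ne_zero h, ?_, ?_⟩
  · intro hu
    have h1 := (lin_dvd_iff (c := c) h 1).1 hu.dvd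
    simp at h1
  · intro a b hab
    rw [lin_dvd_iff h] at hab ⊢
    rw [lin_dvd_iff h]
    rw [map_mul] at hab
    exact mul_eq_zero.1 hab

lemma lin_homog (c : ℂ) (i l : ι) : (lin c i l).IsHomogeneous 1 :=
  (isHomogeneous_X ℂ l).sub (isHomogeneous_C_mul_X c i)

lemma lin_not_dvd {c d : ℂ} {i l m : ι} (hl : l ≠ i) (hm : m ≠ i) (hlm : m ≠ l) :
    ¬ lin c i l ∣ lin d i m := by
  rw [lin_dvd_iff hl]
  simp only [lin, map_sub, map_mul, subst_C, subst_of_ne _ hlm, subst_of_ne _ hl.symm]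
  exact lin_ne_zero hm

lemma totalDegree_subst_le (c : ℂ) (i j : ι) (p : MvPolynomial ι ℂ) :
    (subst j (C c * X i) p).totalDegree ≤ p.totalDegree := by
  unfold subst
  rw [aeval_def, eval₂_eq]
  refine totalDegree_finsetSum_le fun d hd => ?_
  refine le_trans ?_ (le_totalDegree hd)
  apply IsHomogeneous.totalDegree_le
  have hf : ∀ l : ι, (if l = j then C c * X i else X l : MvPolynomial ι ℂ).IsHomogeneous 1 := by
    intro l
    split_ifs
    · exact isHomogeneous_C_mul_X c i
    · exact isHomogeneous_X _ _
  have h1 := (isHomogeneous_C ι (coeff d p)).mul (IsHomogeneous.prod d.support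
    (fun l => (if l = j then C c * X i else X l : MvPolynomial ι ℂ) ^ d l) _
    fun l _ => (hf l).pow (d l))
  simp only [one_mul, zero_add] at h1
  exact h1

/-- Wheel condition for triples of indices in `S`. -/
def WheelOn (S : Finset ι) (p : MvPolynomial ι ℂ) : Prop :=
  ∀ i ∈ S, ∀ j ∈ S, ∀ k ∈ S, i < j → j < k →
    ∀ ψ : MvPolynomial ι ℂ →ₐ[ℂ] MvPolynomial ι ℂ,
      ψ (X j) = C (q ^ 2) * ψ (X i) → ψ (X k) = C (q ^ 4) * ψ (X i) → ψ p = 0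

/-- To test the wheel condition it suffices to use the standard substitution. -/
lemma wheel_of_subst {p : MvPolynomial ι ℂ} {i j k : ι}
    (h : (aeval fun l : ι =>
      if l = j then C (q ^ 2) * X i
      else if l = k then C (q ^ 4) * X i
      else (X l : MvPolynomial ι ℂ)) p = 0)
    (ψ : MvPolynomial ι ℂ →ₐ[ℂ] MvPolynomial ι ℂ)
    (hj : ψ (X j) = C (q ^ 2) * ψ (X i)) (hk : ψ (X k) = C (q ^ 4) * ψ (X i)) : ψ p = 0 := by
  have : ψ = ψ.comp (aeval fun l : ι =>
      if l = j then C (q ^ 2) * X i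
      else if l = k then C (q ^ 4) * X i
      else (X l : MvPolynomial ι ℂ)) := by
    apply MvPolynomial.algHom_ext
    intro m
    rw [AlgHom.comp_apply, aeval_X]
    split_ifs with h1 h2
    · subst h1
      rw [map_mul, hj, algHom_C]; rfl
    · subst h2
      rw [map_mul, hk, algHom_C]; rfl
    · rfl
  rw [this, AlgHom.comp_apply, h, map_zero]

/-- The standard triple substitution. -/
noncomputable def tri (i j k : ι) : MvPolynomial ι ℂ →ₐ[ℂ] MvPolynomial ι ℂ :=
  aeval fun l : ι =>
      if l = j then C (q ^ 2) * X i
      else if l = k then C (q ^ 4) * X i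
      else (X l : MvPolynomial ι ℂ)

lemma tri_i {i j k : ι} (hij : i < j) (hjk : j < k) : tri i j k (X i) = X i := by
  simp [tri, hij.ne, (hij.trans hjk).ne]

lemma tri_j (i j k : ι) : tri i j k (X j) = C (q ^ 2) * X i := by
  simp [tri]

lemma tri_k {i j k : ι} (hjk : j < k) : tri i j k (X k) = C (q ^ 4) * X i := by
  simp [tri, hjk.ne']

lemma tri_other {i j k l : ι} (hj : l ≠ j) (hk : l ≠ k) : tri i j k (X l) = X l := by
  simp [tri, hj, hk]

lemma wheelOn_iff (S : Finset ι) (p : MvPolynomial ι ℂ) :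
    WheelOn S p ↔ ∀ i ∈ S, ∀ j ∈ S, ∀ k ∈ S, i < j → j < k → tri i j k p = 0 := by
  constructor
  · intro h i hi j hj k hk hij hjk
    refine h i hi j hj k hk hij hjk _ ?_ ?_
    · rw [tri_i hij hjk, tri_j]
    · rw [tri_i hij hjk, tri_k hjk]
  · intro h i hi j hj k hk hij hjk ψ h1 h2
    exact wheel_of_subst (h i hi j hj k hk hij hjk) ψ h1 h2

/-- The image of a variable `≠ i` under a triple substitution not involving `x` is not
proportional to `x`. -/
lemma tri_lin_ne_zero {a b c x l : ι} (cc : ℂ) (hab : a < b) (hbc : b < c) (hxa : x ≠ a)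
    (hxb : x ≠ b) (hxc : x ≠ c) (hl : l ≠ x) : tri a b c (lin cc x l) ≠ 0 := by
  intro h0
  have h1 := congrArg (eval fun t => if t = x then (0 : ℂ) else 1) h0
  simp only [lin, map_sub, map_mul, tri_other hxb hxc, algHom_C] at h1
  by_cases h : l = b
  · subst h
    simp [tri_j, hxa.symm, q_ne_zero] at h1
  by_cases h' : l = c
  · subst h'
    simp [tri_k hbc, hxa.symm, q_ne_zero] at h1
  rw [tri_other h h'] at h1
  simp [hl] at h1

/-- The key factorisation. -/
lemma key_factor (S : Finset ι) (p : MvPolynomial ι ℂ) (hp : WheelOn S p) {i j : ι}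
    (hi : i ∈ S) (hj : j ∈ S) (hij : i < j)
    (hb : ∀ l ∈ S, i < l → l < j → lin (q ^ 2) l j ∣ p) :
    ∃ g, subst j (C (q ^ 2) * X i) p =
      (∏ l ∈ (S.erase i).erase j, lin (if i < l ∧ l < j then 1 else q ^ 4) i l) * g ∧
      WheelOn ((S.erase i).erase j) g := by
  have hdvd : (∏ l ∈ (S.erase i).erase j, lin (if i < l ∧ l < j then 1 else q ^ 4) i l) ∣
      subst j (C (q ^ 2) * X i) p := by
    apply Finset.prod_dvd_of_isRelPrime
    · intro l hl m hm hlm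
      simp only [Finset.coe_erase, Set.mem_sdiff, Finset.mem_coe, Set.mem_singleton_iff] at hl hm
      exact (lin_prime hl.1.2).irreducible.isRelPrime_iff_not_dvd.2
        (lin_not_dvd hl.1.2 hm.1.2 (Ne.symm hlm))
    · intro l hl
      simp only [Finset.mem_erase] at hl
      obtain ⟨hlj, hli, hlS⟩ := hl
      rw [lin_dvd_iff hli, ← AlgHom.comp_apply]
      have e1 : ∀ r s : MvPolynomial ι ℂ, (subst l r) (subst j s (X l)) = r := by
        intro r s
        rw [subst_of_ne _ hlj, subst_self]
      have e2 : ∀ r s : MvPolynomial ι ℂ, (subst l r) (subst j s (X i)) = X i := by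
        intro r s
        rw [subst_of_ne _ hij.ne, subst_of_ne _ hli.symm]
      have e3 : ∀ r : MvPolynomial ι ℂ,
          (subst l r) (subst j (C (q ^ 2) * X i) (X j)) = C (q ^ 2) * X i := by
        intro r
        rw [subst_self, map_mul, subst_C, subst_of_ne _ hli.symm]
      by_cases hbt : i < l ∧ l < j
      · rw [if_pos hbt]
        refine algHom_of_lin_dvd (hb l hlS hbt.1 hbt.2) _ ?_
        rw [AlgHom.comp_apply, AlgHom.comp_apply, e3, e1]
        simp
      · rw [if_neg hbt]
        rcases lt_or_gt_of_ne hli with h | h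
        · refine hp l hlS i hi j hj h hij _ ?_ ?_
          · rw [AlgHom.comp_apply, AlgHom.comp_apply, e1, e2, ← mul_assoc, ← C_mul]
            rw [show q ^ 2 * q ^ 4 = 1 by linear_combination (q ^ 3 + 1) * q_pow_three]
            simp
          · rw [AlgHom.comp_apply, AlgHom.comp_apply, e1, e3, ← mul_assoc, ← C_mul]
            rw [show q ^ 4 * q ^ 4 = q ^ 2 by
              linear_combination (q ^ 5 + q ^ 2) * q_pow_three]
        · have hjl : j < l := lt_of_le_of_ne (not_lt.1 fun h' => hbt ⟨h, h'⟩) hlj.symm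
          refine hp i hi j hj l hlS hij hjl _ ?_ ?_
          · rw [AlgHom.comp_apply, AlgHom.comp_apply, e2, e3]
          · rw [AlgHom.comp_apply, AlgHom.comp_apply, e1, e2]
  obtain ⟨g, hg⟩ := hdvd
  refine ⟨g, hg, ?_⟩
  rw [wheelOn_iff]
  intro a ha b hb' c hc hab hbc
  simp only [Finset.mem_erase] at ha hb' hc
  have h1 := congrArg (tri a b c) hg
  rw [map_mul, map_prod, ← AlgHom.comp_apply, hp a ha.2.2 b hb'.2.2 c hc.2.2 hab hbc] at h1
  · rcases mul_eq_zero.1 h1.symm with h2 | h2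
    · exfalso
      obtain ⟨l, hl, h3⟩ := Finset.prod_eq_zero_iff.1 h2
      simp only [Finset.mem_erase] at hl
      exact tri_lin_ne_zero _ hab hbc ha.2.1.symm hb'.2.1.symm hc.2.1.symm hl.2.1 h3
    · exact h2
  · rw [AlgHom.comp_apply, AlgHom.comp_apply, subst_of_ne _ hb'.1, subst_of_ne _ ha.1,
      tri_i hab hbc, tri_j]
  · rw [AlgHom.comp_apply, AlgHom.comp_apply, subst_of_ne _ hc.1, subst_of_ne _ ha.1,
      tri_i hab hbc, tri_k hbc]

/-- degree bookkeeping -/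
lemma totalDegree_prod_lin_mul {T : Finset ι} {i : ι} (hi : ∀ l ∈ T, l ≠ i) (c : ι → ℂ)
    {g : MvPolynomial ι ℂ} (hg : g ≠ 0) :
    ((∏ l ∈ T, lin (c l) i l) * g).totalDegree = T.card + g.totalDegree := by
  have h0 : (∏ l ∈ T, lin (c l) i l) ≠ 0 :=
    Finset.prod_ne_zero_iff.2 fun l hl => lin_ne_zero (hi l hl)
  rw [totalDegree_mul_of_isDomain h0 hg]
  congr 1
  have := (IsHomogeneous.prod T (fun l => lin (c l) i l) (fun _ => 1)
    fun l _ => lin_homog _ _ _).totalDegree h0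
  simpa using this

lemma card_erase_two {S : Finset ι} {n : ℕ} (hS : S.card = 2 * (n + 1)) {i j : ι}
    (hi : i ∈ S) (hj : j ∈ S) (hij : i < j) : ((S.erase i).erase j).card = 2 * n := by
  rw [Finset.card_erase_of_mem (Finset.mem_erase.2 ⟨hij.ne', hj⟩), Finset.card_erase_of_mem hi]
  omega

/-- Counting pairs. -/
lemma card_lt_pairs (S : Finset ι) :
    2 * ((S ×ˢ S).filter fun x => x.1 < x.2).card + S.card = S.card * S.card := by
  set T : Finset (ι × ι) := (S ×ˢ S).filter fun x => x.1 < x.2 with hT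
  have h1 : ((S ×ˢ S).filter fun x => x.2 < x.1).card = T.card := by
    apply Finset.card_bij (fun x _ => (x.2, x.1))
    · intro x hx
      simp only [hT, Finset.mem_filter, Finset.mem_product] at hx ⊢
      exact ⟨⟨hx.1.2, hx.1.1⟩, hx.2⟩
    · rintro ⟨a, b⟩ _ ⟨c, d⟩ _ h
      simp only [Prod.mk.injEq] at h ⊢
      exact ⟨h.2, h.1⟩
    · rintro ⟨a, b⟩ h
      simp only [hT, Finset.mem_filter, Finset.mem_product] at h
      exact ⟨(b, a), by simp [h.1.1, h.1.2, h.2], rfl⟩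
  have h2 : ((S ×ˢ S).filter fun x => x.1 = x.2).card = S.card := by
    symm
    apply Finset.card_bij (fun x _ => (x, x))
    · intro x hx
      simp [hx]
    · intro a _ b _ h
      simpa using h
    · rintro ⟨a, b⟩ h
      simp only [Finset.mem_filter, Finset.mem_product] at h
      exact ⟨a, h.1.1, by rw [← h.2]⟩
  have h3 : (S ×ˢ S).card = T.card + ((S ×ˢ S).filter fun x => x.2 < x.1).card +
      ((S ×ˢ S).filter fun x => x.1 = x.2).card := by
    rw [hT, ← Finset.card_union_of_disjoint, ← Finset.card_union_of_disjoint]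
    · congr 1
      ext x
      simp only [Finset.mem_union, Finset.mem_filter]
      have := lt_trichotomy x.1 x.2
      tauto
    · rw [Finset.disjoint_left]
      intro x hx hx'
      simp only [Finset.mem_union, Finset.mem_filter] at hx hx'
      rcases hx with h | h
      · exact h.2.ne hx'.2
      · exact h.2.ne' hx'.2
    · rw [Finset.disjoint_left]
      intro x hx hx'
      simp only [Finset.mem_filter] at hx hx'
      exact lt_asymm hx.2 hx'.2
  rw [Finset.card_product] at h3
  omega

/-- Low degree wheel polynomials vanish: the statement. -/
def LowVanish (ι : Type) [LinearOrder ι] (n : ℕ) : Prop :=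
  ∀ (S : Finset ι) (p : MvPolynomial ι ℂ), S.card = 2 * n → WheelOn S p →
    p.totalDegree < n * (n - 1) → p = 0

/-- If a wheel polynomial vanishes whenever `z_j = q² z_i` for adjacent `i<j`, it is zero. -/
lemma eq_zero_of_adjacent {n : ℕ} (hA : LowVanish ι n) (S : Finset ι) (p : MvPolynomial ι ℂ)
    (hS : S.card = 2 * (n + 1)) (hp : WheelOn S p) (hdeg : p.totalDegree ≤ (n + 1) * n)
    (hadj : ∀ i ∈ S, ∀ j ∈ S, i < j → (∀ l ∈ S, ¬ (i < l ∧ l < j)) → lin (q ^ 2) i j ∣ p) :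
    p = 0 := by
  have hall : ∀ m : ℕ, ∀ i ∈ S, ∀ j ∈ S, i < j →
      (S.filter fun l => i < l ∧ l < j).card = m → lin (q ^ 2) i j ∣ p := by
    intro m
    induction m using Nat.strong_induction_on with
    | _ m ih =>
    intro i hi j hj hij hm
    by_cases hex : ∀ l ∈ S, ¬ (i < l ∧ l < j)
    · exact hadj i hi j hj hij hex
    push Not at hex
    obtain ⟨l₀, hl₀, hil, hlj⟩ := hex
    have hbl : ∀ l ∈ S, i < l → l < j → lin (q ^ 2) l j ∣ p := by
      intro l hl h1 h2
      refine ih _ ?_ l hl j hj h2 rfl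
      rw [← hm]
      apply Finset.card_lt_card
      refine ⟨fun x hx => ?_, fun hsub => ?_⟩
      · simp only [Finset.mem_filter] at hx ⊢
        exact ⟨hx.1, h1.trans hx.2.1, hx.2.2⟩
      · have := hsub (Finset.mem_filter.2 ⟨hl, h1, h2⟩)
        simp at this
    have hbr : lin (q ^ 2) i l₀ ∣ p := by
      refine ih _ ?_ i hi l₀ hl₀ hil rfl
      rw [← hm]
      apply Finset.card_lt_card
      refine ⟨fun x hx => ?_, fun hsub => ?_⟩
      · simp only [Finset.mem_filter] at hx ⊢
        exact ⟨hx.1, hx.2.1, hx.2.2.trans hlj⟩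
      · have := hsub (Finset.mem_filter.2 ⟨hl₀, hil, hlj⟩)
        simp at this
    obtain ⟨g, hg, hgw⟩ := key_factor S p hp hi hj hij hbl
    rw [lin_dvd_iff hij.ne']
    by_contra hne
    -- the extra factor
    have h1 : lin (q ^ 2) i l₀ ∣ subst j (C (q ^ 2) * X i) p := by
      rw [lin_dvd_iff hil.ne', ← AlgHom.comp_apply]
      refine algHom_of_lin_dvd hbr _ ?_
      rw [AlgHom.comp_apply, AlgHom.comp_apply, subst_of_ne _ hlj.ne, subst_self,
        subst_of_ne _ hij.ne, subst_of_ne _ hil.ne]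
      rfl
    have hgne : g ≠ 0 := by
      rintro rfl
      rw [mul_zero] at hg
      exact hne hg
    have h2 : lin (q ^ 2) i l₀ ∣ g := by
      rw [hg] at h1
      rcases (lin_prime hil.ne').dvd_or_dvd h1 with h3 | h3
      · exfalso
        obtain ⟨l, hl, h4⟩ := (lin_prime hil.ne').exists_mem_finset_dvd h3
        simp only [Finset.mem_erase] at hl
        by_cases hll : l = l₀
        · subst hll
          rw [if_pos ⟨hil, hlj⟩, lin_dvd_iff hil.ne'] at h4
          simp only [lin, map_sub, map_mul, subst_C, subst_self, subst_of_ne _ hil.ne] at h4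
          have h5 := congrArg (eval fun _ => (1 : ℂ)) h4
          simp only [map_sub, map_mul, eval_C, eval_X, map_zero, mul_one] at h5
          exact q_sq_ne_one (sub_eq_zero.1 h5)
        · exact lin_not_dvd hil.ne' hl.2.1 hll h4
      · exact h3
    obtain ⟨g', rfl⟩ := h2
    have hg'ne : g' ≠ 0 := right_ne_zero_of_mul hgne
    refine hg'ne (hA _ g' (card_erase_two hS hi hj hij) ?_ ?_)
    · rw [wheelOn_iff] at hgw ⊢
      intro a ha b hb c hc hab hbc
      have h3 := hgw a ha b hb c hc hab hbc
      simp only [Finset.mem_erase] at ha hb hc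
      rw [map_mul] at h3
      exact (mul_eq_zero.1 h3).resolve_left (tri_lin_ne_zero _ hab hbc ha.2.1.symm hb.2.1.symm
        hc.2.1.symm hil.ne')
    · have hd1 := totalDegree_subst_le (q ^ 2) i j p
      rw [hg, totalDegree_prod_lin_mul (fun l hl => by
        simp only [Finset.mem_erase] at hl; exact hl.2.1) _ hgne,
        card_erase_two hS hi hj hij,
        totalDegree_mul_of_isDomain (lin_ne_zero hil.ne') hg'ne,
        (lin_homog _ _ _).totalDegree (lin_ne_zero hil.ne')] at hd1
      have hd2 := hd1.trans hdeg
      rcases n with _ | n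
      · simp at hd2
      · simp only [Nat.add_sub_cancel]
        nlinarith
  -- now everything divides
  by_contra hne
  set T : Finset (ι × ι) := (S ×ˢ S).filter fun x => x.1 < x.2 with hT
  have hdvd : (∏ x ∈ T, lin (q ^ 2) x.1 x.2) ∣ p := by
    apply Finset.prod_dvd_of_isRelPrime
    · intro x hx y hy hxy
      simp only [hT, Finset.coe_filter, Finset.mem_product, Set.mem_ofPred_eq] at hx hy
      refine (lin_prime hx.2.ne').irreducible.isRelPrime_iff_not_dvd.2 ?_
      rw [lin_dvd_iff hx.2.ne']
      intro h0
      have h1 := congrArg (eval fun t => if t = x.1 then (1 : ℂ) else 0) h0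
      have h2 := congrArg (eval fun t => if t = y.2 then (1 : ℂ) else 0) h0
      have h3 := congrArg (eval fun t => if t = y.1 then (1 : ℂ) else 0) h0
      obtain ⟨i, j⟩ := x
      obtain ⟨k, l⟩ := y
      simp only [lin, map_sub, map_mul, subst_C] at h1 h2 h3 hx hy
      have hij := hx.2
      have hkl := hy.2
      by_cases e1 : l = j
      · subst e1
        have hki : k ≠ i := fun h => hxy (by rw [h])
        rw [subst_self, subst_of_ne _ hkl.ne] at h3
        simp [hki.symm, q_ne_zero] at h3
      · rw [subst_of_ne _ e1] at h2 h1
        by_cases e2 : k = j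
        · subst e2
          rw [subst_self] at h2
          have : i ≠ l := (hij.trans hkl).ne
          simp [this] at h2
        · rw [subst_of_ne _ e2] at h2
          simp [hkl.ne] at h2
    · intro x hx
      simp only [hT, Finset.mem_filter, Finset.mem_product] at hx
      exact hall _ x.1 hx.1.1 x.2 hx.1.2 hx.2 rfl
  have hprod : (∏ x ∈ T, lin (q ^ 2) x.1 x.2) ≠ 0 := by
    refine Finset.prod_ne_zero_iff.2 fun x hx => lin_ne_zero ?_
    simp only [hT, Finset.mem_filter] at hx
    exact hx.2.ne'
  have hle := totalDegree_le_of_dvd_of_isDomain hdvd hne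
  rw [(IsHomogeneous.prod T (fun x => lin (q ^ 2) x.1 x.2) (fun _ => 1)
    fun l _ => lin_homog _ _ _).totalDegree hprod] at hle
  simp only [Finset.sum_const, smul_eq_mul, mul_one] at hle
  -- card of T
  have hcard : 2 * T.card + S.card = S.card * S.card := card_lt_pairs S
  rw [hS] at hcard
  nlinarith

lemma adj_quotient {n : ℕ} (S : Finset ι) (p : MvPolynomial ι ℂ)
    (hS : S.card = 2 * (n + 1)) (hp : WheelOn S p) {i j : ι} (hi : i ∈ S) (hj : j ∈ S)
    (hij : i < j) (hadj : ∀ l ∈ S, ¬ (i < l ∧ l < j)) :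
    ∃ g, subst j (C (q ^ 2) * X i) p = (∏ l ∈ (S.erase i).erase j, lin (q ^ 4) i l) * g ∧
      WheelOn ((S.erase i).erase j) g ∧ (g ≠ 0 → 2 * n + g.totalDegree ≤ p.totalDegree) := by
  obtain ⟨g, hg, hgw⟩ := key_factor S p hp hi hj hij fun l hl h1 h2 => (hadj l hl ⟨h1, h2⟩).elim
  have : ∏ l ∈ (S.erase i).erase j, lin (if i < l ∧ l < j then 1 else q ^ 4) i l =
      ∏ l ∈ (S.erase i).erase j, lin (q ^ 4) i l := by
    refine Finset.prod_congr rfl fun l hl => ?_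
    simp only [Finset.mem_erase] at hl
    rw [if_neg (hadj l hl.2.2)]
  rw [this] at hg
  refine ⟨g, hg, hgw, fun hne => ?_⟩
  have hd1 := totalDegree_subst_le (q ^ 2) i j p
  rw [hg, totalDegree_prod_lin_mul (fun l hl => by
    simp only [Finset.mem_erase] at hl; exact hl.2.1) _ hne, card_erase_two hS hi hj hij] at hd1
  exact hd1

lemma lowVanish (n : ℕ) : LowVanish ι n := by
  induction n with
  | zero => intro S p _ _ h; simp at h
  | succ n ih =>
    intro S p hS hp hdeg
    simp only [Nat.add_sub_cancel] at hdeg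
    refine eq_zero_of_adjacent ih S p hS hp hdeg.le ?_
    intro i hi j hj hij hadj
    obtain ⟨g, hg, hgw, hgd⟩ := adj_quotient S p hS hp hi hj hij hadj
    rw [lin_dvd_iff hij.ne', hg]
    have : g = 0 := by
      by_contra hne
      refine hne (ih _ g (card_erase_two hS hi hj hij) hgw ?_)
      have := hgd hne
      rcases n with _ | n
      · simp at hdeg
      · simp only [Nat.add_sub_cancel]
        nlinarith
    rw [this, mul_zero]

/-- Points coming from Dyck words on the index set `S`. -/
inductive DyckPt : Finset ι → (ι → ℂ) → Prop
  | empty (z : ι → ℂ) : DyckPt ∅ z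
  | step (S : Finset ι) (z : ι → ℂ) (i j : ι) (hi : i ∈ S) (hj : j ∈ S) (hij : i < j)
      (hzi : z i = q⁻¹) (hzj : z j = q) (h : DyckPt ((S.erase i).erase j) z) : DyckPt S z

lemma dyckPt_values {S : Finset ι} {z : ι → ℂ} (h : DyckPt S z) :
    ∀ l ∈ S, z l = q⁻¹ ∨ z l = q := by
  induction h with
  | empty z => simp
  | step S z i j hi hj hij hzi hzj h ih =>
    intro l hl
    by_cases h1 : l = i
    · subst h1; exact Or.inl hzi
    by_cases h2 : l = j
    · subst h2; exact Or.inr hzj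
    exact ih l (by simp [h1, h2, hl])

lemma subst_eval {j : ι} {r : MvPolynomial ι ℂ} {z : ι → ℂ} (h : eval z r = z j)
    (p : MvPolynomial ι ℂ) : eval z (subst j r p) = eval z p := by
  have : (aeval z : MvPolynomial ι ℂ →ₐ[ℂ] ℂ).comp (subst j r) = aeval z := by
    apply MvPolynomial.algHom_ext
    intro m
    rw [AlgHom.comp_apply]
    by_cases hm : m = j
    · subst hm
      rw [subst_self, aeval_X, ← h]; rfl
    · rw [subst_of_ne _ hm]
  exact congrArg (fun f => f p) this

lemma q_inv_ne_one : q⁻¹ ≠ 1 := by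
  simpa using q_ne_one

lemma evals_injective (n : ℕ) : ∀ (S : Finset ι) (p : MvPolynomial ι ℂ) (w : ι → ℂ),
    S.card = 2 * n → WheelOn S p → p.totalDegree ≤ n * (n - 1) →
    (∀ z, (∀ l, l ∉ S → z l = w l) → DyckPt S z → eval z p = 0) → p = 0 := by
  induction n with
  | zero =>
    intro S p w hS _ hdeg h
    have hSe : S = ∅ := by simpa using hS
    subst hSe
    have h1 := h w (fun _ _ => rfl) (DyckPt.empty w)
    simp only [zero_mul, Nat.le_zero] at hdeg
    rw [totalDegree_eq_zero_iff_eq_C] at hdeg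
    rw [hdeg] at h1 ⊢
    rw [eval_C] at h1
    rw [h1, C_0]
  | succ n ih =>
    intro S p w hS hp hdeg h
    simp only [Nat.add_sub_cancel] at hdeg
    refine eq_zero_of_adjacent (lowVanish n) S p hS hp hdeg ?_
    intro i hi j hj hij hadj
    obtain ⟨g, hg, hgw, hgd⟩ := adj_quotient S p hS hp hi hj hij hadj
    rw [lin_dvd_iff hij.ne', hg]
    have : g = 0 := by
      by_contra hne
      refine hne (ih _ g (fun l => if l = i then q⁻¹ else if l = j then q else w l)
        (card_erase_two hS hi hj hij) hgw ?_ ?_)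
      · have := hgd hne
        rcases n with _ | n
        · simp at hdeg; omega
        · simp only [Nat.add_sub_cancel]
          nlinarith
      · intro z hz hD
        have hzi : z i = q⁻¹ := by
          have := hz i (by simp)
          simpa using this
        have hzj : z j = q := by
          have := hz j (by simp)
          simpa [hij.ne'] using this
        have h1 : eval z p = 0 := by
          refine h z ?_ (DyckPt.step S z i j hi hj hij hzi hzj hD)
          intro l hl
          have h1 : l ≠ i := fun e => hl (e ▸ hi)
          have h2 : l ≠ j := fun e => hl (e ▸ hj)
          have := hz l (by simp [hl])
          simpa [h1, h2] using this
        have h2 := subst_eval (j := j) (r := C (q ^ 2) * X i) (z := z) (by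
          simp only [map_mul, eval_C, eval_X, hzi, hzj]
          have := q_ne_zero
          field_simp) p
        rw [h1, hg, map_mul, map_prod] at h2
        refine (mul_eq_zero.1 h2).resolve_left ?_
        refine Finset.prod_ne_zero_iff.2 ?_
        intro l hl h3
        simp only [lin, map_sub, map_mul, eval_C, eval_X, hzi, q_pow_four,
          mul_inv_cancel₀ q_ne_zero] at h3
        rcases dyckPt_values hD l hl with h4 | h4
        · rw [h4] at h3
          exact q_inv_ne_one (sub_eq_zero.1 h3)
        · rw [h4] at h3
          exact q_ne_one (sub_eq_zero.1 h3)
    rw [this, mul_zero]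

end General

/-! ### Homogeneous quotients -/

section Quot
variable {ι : Type}
attribute [local instance] MvPolynomial.gradedAlgebra

lemma homogeneousComponent_lin_mul {L Q : MvPolynomial ι ℂ} (hL : L.IsHomogeneous 1) (k : ℕ) :
    homogeneousComponent (1 + k) (L * Q) = L * homogeneousComponent k Q := by
  have h := DirectSum.coe_decompose_mul_add_of_left_mem
    (homogeneousSubmodule ι ℂ) (a := L) (b := Q) (i := 1) (j := k) hL
  rw [← decomposition.decompose'_apply, ← decomposition.decompose'_apply]
  exact h

lemma quotient_homogeneous {L Q : MvPolynomial ι ℂ} {d : ℕ} (hL : L.IsHomogeneous 1)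
    (hL0 : L ≠ 0) (h : (L * Q).IsHomogeneous d) : Q = 0 ∨ ∃ k, d = 1 + k ∧ Q.IsHomogeneous k := by
  by_cases hQ : Q = 0
  · exact Or.inl hQ
  right
  have h1 := h.totalDegree (mul_ne_zero hL0 hQ)
  rw [totalDegree_mul_of_isDomain hL0 hQ, hL.totalDegree hL0] at h1
  refine ⟨Q.totalDegree, h1.symm, ?_⟩
  have h2 := homogeneousComponent_lin_mul (Q := Q) hL Q.totalDegree
  rw [h1, homogeneousComponent_eq_self h] at h2
  have h3 := mul_left_cancel₀ hL0 h2
  rw [h3]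
  convert homogeneousComponent_isHomogeneous Q.totalDegree Q using 2
  exact h3.symm

end Quot

/-! ### Dyck sequences -/

section Dyck

variable {n : ℕ}

/-- Number of up steps among the first `m`. -/
def upc (s : Fin (2 * n) → Bool) (m : ℕ) : ℕ :=
  (Finset.univ.filter fun l : Fin (2 * n) => (l : ℕ) < m ∧ s l = true).card

def IsDyck (n : ℕ) (s : Fin (2 * n) → Bool) : Prop :=
  upc s (2 * n) = n ∧ ∀ m ≤ 2 * n, m ≤ 2 * upc s m

lemma upc_succ (s : Fin (2 * n) → Bool) (l : Fin (2 * n)) :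
    upc s (l + 1) = upc s l + if s l then 1 else 0 := by
  unfold upc
  split_ifs with h
  · rw [← Finset.card_insert_of_notMem (a := l) (by simp)]
    congr 1
    ext x
    simp only [Finset.mem_filter, Finset.mem_univ, true_and, Finset.mem_insert]
    constructor
    · rintro ⟨h1, h2⟩
      by_cases hx : x = l
      · exact Or.inl hx
      · exact Or.inr ⟨by have : (x : ℕ) ≠ l := fun e => hx (Fin.ext e); omega, h2⟩
    · rintro (rfl | h1)
      · exact ⟨by omega, h⟩
      · exact ⟨by omega, h1.2⟩
  · rw [add_zero]
    congr 1
    ext x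
    simp only [Finset.mem_filter, Finset.mem_univ, true_and]
    constructor
    · rintro ⟨h1, h2⟩
      refine ⟨?_, h2⟩
      have : (x : ℕ) ≠ l := fun e => h (by rw [← Fin.ext e]; exact h2)
      omega
    · rintro ⟨h1, h2⟩
      exact ⟨by omega, h2⟩

lemma upc_mono (s : Fin (2 * n) → Bool) {m m' : ℕ} (h : m ≤ m') : upc s m ≤ upc s m' := by
  apply Finset.card_le_card
  intro x hx
  simp only [Finset.mem_filter, Finset.mem_univ, true_and] at hx ⊢
  exact ⟨by omega, hx.2⟩

lemma upc_le (s : Fin (2 * n) → Bool) (m : ℕ) : upc s m ≤ 2 * n := by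
  refine (Finset.card_le_univ _).trans ?_
  simp

lemma upc_add_down (s : Fin (2 * n) → Bool) {m : ℕ} (hm : m ≤ 2 * n) :
    upc s m + (Finset.univ.filter fun l : Fin (2 * n) => (l : ℕ) < m ∧ s l = false).card = m := by
  unfold upc
  rw [← Finset.card_union_of_disjoint]
  · rw [← Finset.filter_or]
    have : (Finset.univ.filter fun l : Fin (2 * n) =>
        ((l : ℕ) < m ∧ s l = true) ∨ ((l : ℕ) < m ∧ s l = false)) =
        Finset.univ.filter fun l : Fin (2 * n) => (l : ℕ) < m := by
      ext x
      simp only [Finset.mem_filter, Finset.mem_univ, true_and]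
      cases s x <;> simp
    rw [this, Fin.card_filter_val_lt]
    omega
  · rw [Finset.disjoint_left]
    intro x hx hy
    simp only [Finset.mem_filter, Finset.mem_univ, true_and] at hx hy
    simp [hx.2] at hy

/-- Adjacent transposition preserves the order of pairs other than the transposed one. -/
lemma swap_lt {i i' : Fin (2 * n)} (hi : (i' : ℕ) = i + 1) {a b : Fin (2 * n)} (hab : a < b)
    (h : ¬ (a = i ∧ b = i')) : Equiv.swap i i' a < Equiv.swap i i' b := by
  simp only [Equiv.swap_apply_def]
  simp only [Fin.ext_iff, Fin.lt_def] at *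
  split_ifs <;> omega

lemma upc_swap {i i' : Fin (2 * n)} (hi : (i' : ℕ) = i + 1) (s : Fin (2 * n) → Bool) {m : ℕ}
    (hm : m ≠ i + 1) : upc (s ∘ Equiv.swap i i') m = upc s m := by
  unfold upc
  apply Finset.card_equiv (Equiv.swap i i')
  intro x
  simp only [Finset.mem_filter, Finset.mem_univ, true_and, Function.comp_apply]
  have : ((x : ℕ) < m) ↔ ((Equiv.swap i i' x : Fin (2 * n)) : ℕ) < m := by
    simp only [Equiv.swap_apply_def]
    simp only [Fin.ext_iff] at *
    split_ifs <;> omega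
  rw [this]

/-- Path order. -/
def PGe (ρ σ : Fin (2 * n) → Bool) : Prop := ∀ m, upc σ m ≤ upc ρ m

lemma pge_of_swap {i i' : Fin (2 * n)} (hi : (i' : ℕ) = i + 1) {ρ σ : Fin (2 * n) → Bool}
    (h0 : σ i = false) (h : PGe (ρ ∘ Equiv.swap i i') (σ ∘ Equiv.swap i i')) : PGe ρ σ := by
  intro m
  by_cases hm : m = i + 1
  · subst hm
    rw [upc_succ, h0]
    have := h i
    rw [upc_swap hi _ (by omega), upc_swap hi _ (by omega)] at this
    simpa using this.trans (upc_mono ρ (by omega))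
  · have := h m
    rwa [upc_swap hi _ hm, upc_swap hi _ hm] at this

lemma upc_swap_valley {i i' : Fin (2 * n)} (hi : (i' : ℕ) = i + 1) {σ : Fin (2 * n) → Bool}
    (h0 : σ i = false) (h1 : σ i' = true) :
    upc (σ ∘ Equiv.swap i i') (i + 1) = upc σ (i + 1) + 1 := by
  rw [upc_succ, upc_succ, upc_swap hi _ (by omega)]
  simp [h0, h1]

lemma pge_swap_valley {i i' : Fin (2 * n)} (hi : (i' : ℕ) = i + 1) {σ : Fin (2 * n) → Bool}
    (h0 : σ i = false) (h1 : σ i' = true) : PGe (σ ∘ Equiv.swap i i') σ := by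
  intro m
  by_cases hm : m = i + 1
  · subst hm
    rw [upc_swap_valley hi h0 h1]
    omega
  · rw [upc_swap hi _ hm]

/-- The evaluation point of a sequence. -/
noncomputable def pt (s : Fin (2 * n) → Bool) : Fin (2 * n) → ℂ := fun l => if s l then q⁻¹ else q

/-- Coefficient for up / down. -/
noncomputable def cf (b : Bool) : ℂ := if b then q⁻¹ else q

lemma cf_ne_zero (b : Bool) : cf b ≠ 0 := by
  unfold cf
  split_ifs
  · exact inv_ne_zero q_ne_zero
  · exact q_ne_zero

/-- (Possibly crossing) perfect matchings. -/
def IsMatch (e : Fin n × Bool ≃ Fin (2 * n)) : Prop := ∀ m, e (m, true) < e (m, false)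

def path (e : Fin n × Bool ≃ Fin (2 * n)) : Fin (2 * n) → Bool := fun l => (e.symm l).2

/-- Restriction to the linear space attached to a matching. -/
noncomputable def VV (e : Fin n × Bool ≃ Fin (2 * n)) :
    MvPolynomial (Fin (2 * n)) ℂ →ₐ[ℂ] MvPolynomial (Fin n) ℂ :=
  aeval fun l => C (cf (e.symm l).2) * X (e.symm l).1

lemma VV_X (e : Fin n × Bool ≃ Fin (2 * n)) (l : Fin (2 * n)) :
    VV e (X l) = C (cf (e.symm l).2) * X (e.symm l).1 := by
  simp [VV]

lemma eval_path (e : Fin n × Bool ≃ Fin (2 * n)) (P : MvPolynomial (Fin (2 * n)) ℂ) :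
    eval (pt (path e)) P = eval (fun _ => 1) (VV e P) := by
  have : (aeval (pt (path e)) : MvPolynomial (Fin (2 * n)) ℂ →ₐ[ℂ] ℂ) =
      (aeval (fun _ => (1 : ℂ)) : MvPolynomial (Fin n) ℂ →ₐ[ℂ] ℂ).comp (VV e) := by
    apply MvPolynomial.algHom_ext
    intro l
    rw [AlgHom.comp_apply, VV_X]
    simp only [aeval_X, pt, path, cf, map_mul, mul_one, algHom_C]
    rfl
  exact congrArg (fun f => f P) this

/-- Existence of a matching with given Dyck path. -/
lemma exists_match {s : Fin (2 * n) → Bool} (hs : IsDyck n s) :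
    ∃ e : Fin n × Bool ≃ Fin (2 * n), IsMatch e ∧ path e = s := by
  have hdn := upc_add_down s le_rfl
  rw [hs.1] at hdn
  have hA : (Finset.univ.filter fun l : Fin (2 * n) => s l = true).card = n := by
    refine Eq.trans ?_ hs.1
    unfold upc
    congr 1
    ext x
    simp
  have hB : (Finset.univ.filter fun l : Fin (2 * n) => s l = false).card = n := by
    have : (Finset.univ.filter fun l : Fin (2 * n) => (l : ℕ) < 2 * n ∧ s l = false) =
        Finset.univ.filter fun l : Fin (2 * n) => s l = false := by
      ext x
      simp
    rw [this] at hdn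
    omega
  set a := Finset.orderEmbOfFin _ hA with ha
  set b := Finset.orderEmbOfFin _ hB with hb
  have has : ∀ m, s (a m) = true := fun m => by
    exact (Finset.mem_filter.1 (Finset.orderEmbOfFin_mem _ hA m)).2
  have hbs : ∀ m, s (b m) = false := fun m => by
    exact (Finset.mem_filter.1 (Finset.orderEmbOfFin_mem _ hB m)).2
  let f : Fin n × Bool → Fin (2 * n) := fun x => if x.2 then a x.1 else b x.1
  have hfs : ∀ x, s (f x) = x.2 := by
    rintro ⟨m, _ | _⟩
    · exact hbs m
    · exact has m
  have hinj : Function.Injective f := by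
    rintro ⟨m, c⟩ ⟨m', c'⟩ h
    have h2 := congrArg s h
    rw [hfs, hfs] at h2
    simp only at h2
    subst h2
    cases c
    · have : m = m' := b.injective h
      rw [this]
    · have : m = m' := a.injective h
      rw [this]
  have hbij : Function.Bijective f := by
    rw [Fintype.bijective_iff_injective_and_card]
    refine ⟨hinj, ?_⟩
    simp [mul_comm]
  refine ⟨Equiv.ofBijective f hbij, ?_, ?_⟩
  · intro m
    change a m < b m
    by_contra hlt
    have hba : b m < a m := by
      refine lt_of_le_of_ne (not_lt.1 hlt) fun h => ?_
      have h1 := has m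
      rw [← h, hbs m] at h1
      exact Bool.false_ne_true h1
    have hM : (b m : ℕ) + 1 ≤ 2 * n := (b m).2
    have h1 := hs.2 _ hM
    have h2 := upc_add_down s hM
    have h3 : upc s (b m + 1) ≤ m := by
      have : (Finset.univ.filter fun l : Fin (2 * n) => (l : ℕ) < b m + 1 ∧ s l = true) ⊆
          (Finset.Iio m).image a := by
        intro x hx
        simp only [Finset.mem_filter, Finset.mem_univ, true_and] at hx
        have hx' : x ∈ Set.range a := by
          rw [ha, Finset.range_orderEmbOfFin]
          simpa using hx.2
        obtain ⟨y, rfl⟩ := hx'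
        refine Finset.mem_image_of_mem _ (Finset.mem_Iio.2 ?_)
        have : a y < a m := lt_of_le_of_lt (Fin.le_def.2 (by omega)) hba
        exact a.lt_iff_lt.1 this
      refine (Finset.card_le_card this).trans (Finset.card_image_le.trans ?_)
      simp
    have h4 : (m : ℕ) + 1 ≤
        (Finset.univ.filter fun l : Fin (2 * n) => (l : ℕ) < b m + 1 ∧ s l = false).card := by
      have : (Finset.Iic m).image b ⊆
          (Finset.univ.filter fun l : Fin (2 * n) => (l : ℕ) < b m + 1 ∧ s l = false) := by
        intro x hx
        obtain ⟨y, hy, rfl⟩ := Finset.mem_image.1 hx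
        simp only [Finset.mem_filter, Finset.mem_univ, true_and]
        refine ⟨?_, hbs y⟩
        have : b y ≤ b m := b.monotone (Finset.mem_Iic.1 hy)
        have := Fin.le_def.1 this
        omega
      refine le_trans ?_ (Finset.card_le_card this)
      rw [Finset.card_image_of_injective _ b.injective]
      simp
    omega
  · funext l
    obtain ⟨x, rfl⟩ := hbij.2 l
    rw [hfs]
    have : (Equiv.ofBijective f hbij).symm (f x) = x :=
      (Equiv.ofBijective f hbij).symm_apply_apply x
    simp only [path, this]

/-- The inductive property for the lower bound. -/
structure Good (σ : Fin (2 * n) → Bool) (P : MvPolynomial (Fin (2 * n)) ℂ) : Prop where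
  wheel : WheelOn Finset.univ P
  homog : P.IsHomogeneous (n * (n - 1))
  ne : eval (pt σ) P ≠ 0
  van : ∀ e, IsMatch e → ¬ PGe (path e) σ → VV e P = 0

lemma good_base {s : Fin (2 * n) → Bool} (hs : IsDyck n s)
    (hanti : ∀ i j, i < j → s j = true → s i = true) : ∃ P, Good s P := by
  have hdn := upc_add_down s le_rfl
  rw [hs.1] at hdn
  have hA : (Finset.univ.filter fun l : Fin (2 * n) => s l = true).card = n := by
    refine Eq.trans ?_ hs.1
    unfold upc
    congr 1
    ext x
    simp
  have hB : (Finset.univ.filter fun l : Fin (2 * n) => s l = false).card = n := by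
    have : (Finset.univ.filter fun l : Fin (2 * n) => (l : ℕ) < 2 * n ∧ s l = false) =
        Finset.univ.filter fun l : Fin (2 * n) => s l = false := by
      ext x
      simp
    rw [this] at hdn
    omega
  let A : Bool → Finset (Fin (2 * n)) := fun b => Finset.univ.filter fun l => s l = b
  let T : Bool → Finset (Fin (2 * n) × Fin (2 * n)) := fun b =>
    (A b ×ˢ A b).filter fun x => x.1 < x.2
  have hT : ∀ b, 2 * (T b).card + n = n * n := by
    intro b
    have := card_lt_pairs (A b)
    have hAb : (A b).card = n := by
      cases b
      · exact hB
      · exact hA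
    rw [hAb] at this
    exact this
  let P : MvPolynomial (Fin (2 * n)) ℂ := ∏ b, ∏ x ∈ T b, lin (q ^ 2) x.1 x.2
  have hmem : ∀ i j, i < j → s i = s j → lin (q ^ 2) i j ∣ P := by
    intro i j hij h
    refine dvd_trans ?_ (Finset.dvd_prod_of_mem _ (Finset.mem_univ (s i)))
    exact Finset.dvd_prod_of_mem (fun x : Fin (2 * n) × Fin (2 * n) => lin (q ^ 2) x.1 x.2)
      (a := (i, j)) (by simp [T, A, hij, h])
  refine ⟨P, ?_, ?_, ?_, ?_⟩
  · intro i _ j _ k _ hij hjk ψ h1 h2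
    by_cases h : s i = s j
    · exact algHom_of_lin_dvd (hmem i j hij h) ψ h1
    · have h3 : s j = false := by
        by_contra h3
        have h3' : s j = true := by simpa using h3
        exact h (by rw [h3', hanti i j hij h3'])
      have h4 : s k = false := by
        by_contra h4
        have h4' : s k = true := by simpa using h4
        rw [hanti j k hjk h4'] at h3
        exact Bool.false_ne_true h3.symm
      refine algHom_of_lin_dvd (hmem j k hjk (h3.trans h4.symm)) ψ ?_
      rw [h2, h1, MvPolynomial.algebraMap_eq, ← mul_assoc, ← C_mul]
      ring_nf
  · have h1 : P.IsHomogeneous (∑ b : Bool, ∑ x ∈ T b, 1) :=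
      IsHomogeneous.prod _ _ _ fun b _ => IsHomogeneous.prod _ _ _ fun x _ => lin_homog _ _ _
    convert h1 using 1
    simp only [Fintype.sum_bool, Finset.sum_const, smul_eq_mul, mul_one]
    have e1 := hT true
    have e2 := hT false
    rw [Nat.mul_sub, mul_one]
    omega
  · simp only [P, map_prod]
    refine Finset.prod_ne_zero_iff.2 fun b _ => Finset.prod_ne_zero_iff.2 fun x hx => ?_
    simp only [T, A, Finset.mem_filter, Finset.mem_product, Finset.mem_univ, true_and] at hx
    simp only [lin, map_sub, map_mul, eval_X, eval_C, pt, hx.1.1, hx.1.2]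
    intro h0
    have h1 : (1 - q ^ 2) * cf b = 0 := by
      unfold cf
      linear_combination h0
    rcases mul_eq_zero.1 h1 with h2 | h2
    · exact q_sq_ne_one (sub_eq_zero.1 h2).symm
    · exact cf_ne_zero b h2
  · intro e he hge
    by_cases hex : ∃ m, s (e (m, true)) = s (e (m, false))
    · obtain ⟨m, hm⟩ := hex
      refine algHom_of_lin_dvd (hmem _ _ (he m) hm) (VV e) ?_
      rw [VV_X, VV_X, MvPolynomial.algebraMap_eq]
      simp only [Equiv.symm_apply_apply, ← mul_assoc, ← C_mul, cf]
      congr 2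
      have := q_ne_zero
      simp only [if_true, Bool.false_eq_true, if_false]
      field_simp
    · exfalso
      apply hge
      push Not at hex
      have : path e = s := by
        funext l
        obtain ⟨⟨m, c⟩, rfl⟩ := e.surjective l
        have h1 := hex m
        have h2 : s (e (m, false)) = false := by
          by_contra h3
          have h3' : s (e (m, false)) = true := by simpa using h3
          exact h1 (by rw [h3', hanti _ _ (he m) h3'])
        have h4 : s (e (m, true)) = true := by
          rw [h2] at h1
          simpa using h1
        simp only [path, Equiv.symm_apply_apply]
        cases c
        · exact h2.symm
        · exact h4.symm
      rw [this]
      intro m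
      exact le_rfl

lemma good_step {σ : Fin (2 * n) → Bool} (hσ : IsDyck n σ) {i i' : Fin (2 * n)}
    (hi : (i' : ℕ) = i + 1) (h0 : σ i = false) (h1 : σ i' = true)
    {P : MvPolynomial (Fin (2 * n)) ℂ} (hP : Good (σ ∘ Equiv.swap i i') P) : ∃ P', Good σ P' := by
  have hlt : i < i' := Fin.lt_def.2 (by omega)
  have hne : i' ≠ i := hlt.ne'
  have hdvd : lin 1 i i' ∣ rename (Equiv.swap i i') P - P := by
    rw [lin_dvd_iff hne, map_sub, sub_eq_zero]
    have : (subst i' (C (1 : ℂ) * X i)).comp (rename (Equiv.swap i i')) =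
        subst i' (C (1 : ℂ) * X i) := by
      apply MvPolynomial.algHom_ext
      intro m
      rw [AlgHom.comp_apply, rename_X]
      by_cases e1 : m = i
      · subst e1
        rw [Equiv.swap_apply_left, subst_self, subst_of_ne _ hlt.ne]
        simp
      by_cases e2 : m = i'
      · subst e2
        rw [Equiv.swap_apply_right, subst_self, subst_of_ne _ hlt.ne]
        simp
      rw [Equiv.swap_apply_of_ne_of_ne e1 e2]
    exact congrArg (fun f => f P) this
  obtain ⟨Q, hQ⟩ := hdvd
  refine ⟨lin (q ^ 2) i i' * Q, ?_, ?_, ?_, ?_⟩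
  · rw [wheelOn_iff]
    intro a _ b _ c _ hab hbc
    rw [map_mul]
    by_cases c1 : a = i ∧ b = i'
    · obtain ⟨rfl, rfl⟩ := c1
      rw [algHom_of_lin_dvd (dvd_refl (lin (q ^ 2) a b)) (tri a b c) (by
        rw [tri_i hab hbc, tri_j]; rfl), zero_mul]
    by_cases c2 : b = i ∧ c = i'
    · obtain ⟨rfl, rfl⟩ := c2
      rw [algHom_of_lin_dvd (dvd_refl (lin (q ^ 2) b c)) (tri a b c) (by
        rw [tri_k hbc, tri_j, MvPolynomial.algebraMap_eq, ← mul_assoc, ← C_mul]; ring_nf),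
        zero_mul]
    have hQ0 : tri a b c Q = 0 := by
      have h2 := congrArg (tri a b c) hQ
      have hP1 : tri a b c P = 0 :=
        (wheelOn_iff _ _).1 hP.wheel a (Finset.mem_univ _) b (Finset.mem_univ _) c
          (Finset.mem_univ _) hab hbc
      have hP2 : ((tri a b c).comp (rename (Equiv.swap i i'))) P = 0 := by
        refine hP.wheel (Equiv.swap i i' a) (Finset.mem_univ _) (Equiv.swap i i' b)
          (Finset.mem_univ _) (Equiv.swap i i' c) (Finset.mem_univ _) (swap_lt hi hab c1)
          (swap_lt hi hbc c2) _ ?_ ?_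
        · simp only [AlgHom.comp_apply, rename_X, Equiv.swap_apply_self]
          rw [tri_i hab hbc, tri_j]
        · simp only [AlgHom.comp_apply, rename_X, Equiv.swap_apply_self]
          rw [tri_i hab hbc, tri_k hbc]
      rw [AlgHom.comp_apply] at hP2
      rw [map_sub, map_mul, hP1, hP2, sub_zero] at h2
      refine (mul_eq_zero.1 h2.symm).resolve_left ?_
      by_cases hni : i ≠ a ∧ i ≠ b ∧ i ≠ c
      · exact tri_lin_ne_zero _ hab hbc hni.1 hni.2.1 hni.2.2 hne
      · have hni' : i' ≠ a ∧ i' ≠ b ∧ i' ≠ c := by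
          simp only [Fin.ext_iff, Fin.lt_def, ne_eq] at *
          omega
        have h3 := tri_lin_ne_zero 1 hab hbc hni'.1 hni'.2.1 hni'.2.2 hlt.ne
        intro h4
        apply h3
        have : (lin 1 i' i : MvPolynomial (Fin (2 * n)) ℂ) = - lin 1 i i' := by
          simp [lin]
        rw [this, map_neg, h4, neg_zero]
    rw [hQ0, mul_zero]
  · have hh : (lin 1 i i' * Q).IsHomogeneous (n * (n - 1)) := by
      rw [← hQ]
      exact (hP.homog.rename_isHomogeneous).sub hP.homog
    rcases quotient_homogeneous (lin_homog _ _ _) (lin_ne_zero hne) hh with h2 | ⟨k, hk, h2⟩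
    · rw [h2, mul_zero]
      exact isHomogeneous_zero _ _ _
    · rw [hk]
      exact (lin_homog _ _ _).mul h2
  · obtain ⟨e, he, hpe⟩ := exists_match hσ
    have hz : eval (pt σ) P = 0 := by
      rw [← hpe, eval_path, hP.van e he, map_zero]
      rw [hpe]
      intro h
      have := h (i + 1)
      rw [upc_swap_valley hi h0 h1] at this
      omega
    have h2 := congrArg (eval (pt σ)) hQ
    rw [map_sub, hz, sub_zero, map_mul, eval_rename] at h2
    have h3 := hP.ne
    have h4 : pt σ ∘ Equiv.swap i i' = pt (σ ∘ Equiv.swap i i') := rfl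
    rw [h4] at h2
    rw [h2] at h3
    rw [map_mul]
    refine mul_ne_zero ?_ (right_ne_zero_of_mul h3)
    simp only [lin, map_sub, map_mul, eval_X, eval_C, pt, h0, h1]
    simp only [if_true, Bool.false_eq_true, if_false]
    rw [← pow_succ, q_pow_three]
    exact sub_ne_zero.2 q_inv_ne_one
  · intro e he hge
    rw [map_mul]
    by_cases hs : (e.symm i).1 = (e.symm i').1
    · have h2 : VV e (lin (q ^ 2) i i') = 0 := by
        refine algHom_of_lin_dvd (dvd_refl _) (VV e) ?_
        obtain ⟨⟨m, c⟩, hmc⟩ := e.surjective i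
        obtain ⟨⟨m', c'⟩, hmc'⟩ := e.surjective i'
        rw [← hmc, ← hmc', Equiv.symm_apply_apply, Equiv.symm_apply_apply] at hs
        simp only at hs
        subst hs
        have h3 := he m
        have hc : c = true ∧ c' = false := by
          rw [← hmc, ← hmc'] at hlt
          cases c <;> cases c'
          · exact absurd hlt (lt_irrefl _)
          · exact absurd hlt (lt_asymm h3)
          · exact ⟨rfl, rfl⟩
          · exact absurd hlt (lt_irrefl _)
        rw [VV_X, VV_X, MvPolynomial.algebraMap_eq, ← hmc, ← hmc']
        simp only [Equiv.symm_apply_apply, ← mul_assoc, ← C_mul, cf, hc.1, hc.2]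
        congr 2
        have := q_ne_zero
        simp only [if_true, Bool.false_eq_true, if_false]
        field_simp
      rw [h2, zero_mul]
    · have hQ0 : VV e Q = 0 := by
        have h2 := congrArg (VV e) hQ
        have h3 : VV e P = 0 := hP.van e he fun h =>
          hge fun m => (pge_swap_valley hi h0 h1 m).trans (h m)
        have h4 : (VV e).comp (rename (Equiv.swap i i')) = VV (e.trans (Equiv.swap i i')) := by
          apply MvPolynomial.algHom_ext
          intro m
          rw [AlgHom.comp_apply, rename_X, VV_X, VV_X]
          simp
        have h5 : VV (e.trans (Equiv.swap i i')) P = 0 := by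
          refine hP.van _ ?_ ?_
          · intro m
            simp only [Equiv.trans_apply]
            refine swap_lt hi (he m) ?_
            rintro ⟨h6, h7⟩
            apply hs
            rw [← h6, ← h7, Equiv.symm_apply_apply, Equiv.symm_apply_apply]
          · intro h
            apply hge
            refine pge_of_swap hi h0 ?_
            have : path (e.trans (Equiv.swap i i')) = path e ∘ Equiv.swap i i' := by
              funext l
              simp [path]
            rw [← this]
            exact h
        rw [map_sub, map_mul, h3, sub_zero, ← AlgHom.comp_apply, h4, h5] at h2
        refine (mul_eq_zero.1 h2.symm).resolve_left ?_
        intro h6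
        have h7 := congrArg (eval fun t => if t = (e.symm i).1 then (1 : ℂ) else 0) h6
        simp only [lin, map_sub, map_mul, VV_X, algHom_C, MvPolynomial.algebraMap_eq, eval_C,
          eval_X, if_neg (Ne.symm hs), if_true, map_zero, mul_zero, zero_sub, mul_one, one_mul,
          neg_eq_zero] at h7
        exact cf_ne_zero _ h7
      rw [hQ0, mul_zero]

lemma isDyck_swap {σ : Fin (2 * n) → Bool} (hσ : IsDyck n σ) {i i' : Fin (2 * n)}
    (hi : (i' : ℕ) = i + 1) (h0 : σ i = false) (h1 : σ i' = true) :
    IsDyck n (σ ∘ Equiv.swap i i') := by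
  refine ⟨?_, fun m hm => ?_⟩
  · rw [upc_swap hi _ (by have := i'.2; omega)]
    exact hσ.1
  · have := hσ.2 m hm
    have := pge_swap_valley hi h0 h1 m
    omega

lemma exists_good (N : ℕ) : ∀ σ : Fin (2 * n) → Bool, IsDyck n σ →
    ∑ m ∈ Finset.range (2 * n + 1), (2 * n - upc σ m) = N → ∃ P, Good σ P := by
  induction N using Nat.strong_induction_on with
  | _ N ih =>
  intro σ hσ hN
  by_cases hv : ∃ i i' : Fin (2 * n), (i' : ℕ) = i + 1 ∧ σ i = false ∧ σ i' = true
  · obtain ⟨i, i', hi, h0, h1⟩ := hv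
    obtain ⟨P, hP⟩ := ih _ (by
      rw [← hN]
      refine Finset.sum_lt_sum (fun m _ => ?_) ⟨i + 1, ?_, ?_⟩
      · have := pge_swap_valley hi h0 h1 m
        omega
      · have := i'.2
        simp only [Finset.mem_range]
        omega
      · have h2 := upc_swap_valley hi h0 h1
        have h3 := upc_le (σ ∘ Equiv.swap i i') (i + 1)
        omega) (σ ∘ Equiv.swap i i') (isDyck_swap hσ hi h0 h1) rfl
    exact good_step hσ hi h0 h1 hP
  · push Not at hv
    refine good_base hσ ?_
    have key : ∀ d : ℕ, ∀ i j : Fin (2 * n), (j : ℕ) = i + d → σ j = true → σ i = true := by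
      intro d
      induction d with
      | zero =>
        intro i j hij h
        have e : j = i := Fin.ext (by simpa using hij)
        rwa [← e]
      | succ d ihd =>
        intro i j hij h
        have hj := j.2
        by_contra h2
        have h2' : σ i = false := by simpa using h2
        have h3 := hv i ⟨i + 1, by omega⟩ rfl h2'
        exact h3 (ihd ⟨i + 1, by omega⟩ j (by simp only; omega) h)
    intro i j hij h
    exact key (j - i) i j (by have := Fin.lt_def.1 hij; omega) h

end Dyck

/-! ### Dyck points come from Dyck sequences -/

section Count

variable {n : ℕ}

lemma q_inv_ne_q : q⁻¹ ≠ q := by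
  intro h
  have h1 : q * q = 1 := by
    nth_rewrite 1 [← h]
    exact inv_mul_cancel₀ q_ne_zero
  exact q_sq_ne_one (by rw [sq]; exact h1)

lemma dyckPt_count {N : ℕ} {S : Finset (Fin N)} {z : Fin N → ℂ} (h : DyckPt S z) (m : ℕ) :
    (S.filter fun l : Fin N => (l : ℕ) < m ∧ z l = q).card ≤
      (S.filter fun l : Fin N => (l : ℕ) < m ∧ z l = q⁻¹).card ∧
    (S.filter fun l : Fin N => z l = q).card = (S.filter fun l : Fin N => z l = q⁻¹).card := by
  induction h with
  | empty z => simp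
  | step S z i j hi hj hij hzi hzj h ih =>
    have key : ∀ (p : Fin N → Prop) [DecidablePred p], (S.filter p).card =
        (if p i then 1 else 0) + ((if p j then 1 else 0) +
          (((S.erase i).erase j).filter p).card) := by
      intro p _
      rw [Finset.card_filter, Finset.card_filter,
        Finset.add_sum_erase (S.erase i) (fun l => if p l then 1 else 0)
          (Finset.mem_erase.2 ⟨hij.ne', hj⟩),
        Finset.add_sum_erase S (fun l => if p l then 1 else 0) hi]
    rw [key fun l : Fin N => (l : ℕ) < m ∧ z l = q, key fun l : Fin N => (l : ℕ) < m ∧ z l = q⁻¹,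
      key fun l : Fin N => z l = q, key fun l : Fin N => z l = q⁻¹]
    have hlt := Fin.lt_def.1 hij
    obtain ⟨ih1, ih2⟩ := ih
    refine ⟨?_, ?_⟩
    · simp only [hzi, hzj, q_inv_ne_q, q_inv_ne_q.symm, and_false, if_false, and_true]
      split_ifs <;> omega
    · simp only [hzi, hzj, q_inv_ne_q, q_inv_ne_q.symm, if_false, if_true]
      omega

lemma dyckPt_univ {z : Fin (2 * n) → ℂ} (h : DyckPt Finset.univ z) :
    ∃ s, IsDyck n s ∧ z = pt s := by
  have hv := dyckPt_values h
  have hz : z = pt fun l => decide (z l = q⁻¹) := by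
    funext l
    unfold pt
    rcases hv l (Finset.mem_univ _) with h1 | h1 <;> simp [h1, q_inv_ne_q.symm]
  have hup : ∀ m, upc (fun l => decide (z l = q⁻¹)) m =
      (Finset.univ.filter fun l : Fin (2 * n) => (l : ℕ) < m ∧ z l = q⁻¹).card := by
    intro m
    unfold upc
    congr 1
    ext x
    simp
  have hdn : ∀ m, (Finset.univ.filter fun l : Fin (2 * n) =>
      (l : ℕ) < m ∧ (fun l => decide (z l = q⁻¹)) l = false).card =
      (Finset.univ.filter fun l : Fin (2 * n) => (l : ℕ) < m ∧ z l = q).card := by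
    intro m
    congr 1
    ext x
    rcases hv x (Finset.mem_univ _) with h1 | h1 <;>
      simp [h1, q_inv_ne_q.symm, q_inv_ne_q]
  refine ⟨fun l => decide (z l = q⁻¹), ⟨?_, ?_⟩, hz⟩
  · have h1 := upc_add_down (fun l => decide (z l = q⁻¹)) (le_refl (2 * n))
    rw [hdn, hup] at h1
    have h2 := (dyckPt_count h 0).2
    rw [hup]
    simp only [Fin.is_lt, true_and] at h1 ⊢
    omega
  · intro m hm
    have h1 := upc_add_down (fun l => decide (z l = q⁻¹)) hm
    rw [hdn, hup] at h1
    have h2 := (dyckPt_count h m).1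
    rw [hup]
    omega

/-! ### Counting Dyck sequences -/

def toStep (b : Bool) : DyckStep := if b then DyckStep.U else DyckStep.D

def wd (s : Fin (2 * n) → Bool) : List DyckStep := List.ofFn fun l => toStep (s l)

lemma wd_length (s : Fin (2 * n) → Bool) : (wd s).length = 2 * n := by simp [wd]

lemma wd_count (s : Fin (2 * n) → Bool) (m : ℕ) (hm : m ≤ 2 * n) :
    ((wd s).take m).count DyckStep.U = upc s m ∧
    ((wd s).take m).count DyckStep.D + upc s m = m := by
  induction m with
  | zero => simp [upc]
  | succ m ih =>
    obtain ⟨ih1, ih2⟩ := ih (by omega)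
    have hlt : m < (wd s).length := by rw [wd_length]; omega
    rw [List.take_succ_eq_append_getElem hlt, List.count_append, List.count_append]
    have hu := upc_succ s ⟨m, by omega⟩
    simp only at hu
    have hg : (wd s)[m] = toStep (s ⟨m, by omega⟩) := by simp [wd]
    rw [hg, hu]
    cases hsm : s ⟨m, by omega⟩
    · simp [toStep, ih1]
      omega
    · simp [toStep, ih1]
      omega

lemma wd_take (s : Fin (2 * n) → Bool) : (wd s).take (2 * n) = wd s := by
  rw [List.take_of_length_le]
  rw [wd_length]

def toDyck (s : {s : Fin (2 * n) → Bool // IsDyck n s}) : {p : DyckWord // p.semilength = n} :=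
  ⟨⟨wd s.1, by
    have h := wd_count s.1 (2 * n) le_rfl
    rw [wd_take, s.2.1] at h
    omega, by
    intro i
    by_cases hi : i ≤ 2 * n
    · have h := wd_count s.1 i hi
      have h2 := s.2.2 i hi
      omega
    · have h := wd_count s.1 (2 * n) le_rfl
      rw [List.take_of_length_le (by rw [wd_length]; omega)]
      rw [wd_take, s.2.1] at h
      omega⟩, by
    have h := wd_count s.1 (2 * n) le_rfl
    rw [wd_take, s.2.1] at h
    exact h.1⟩

lemma toStep_inj : Function.Injective toStep := by
  intro a b h
  cases a <;> cases b <;> simp [toStep] at h ⊢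

lemma toDyck_bij : Function.Bijective (toDyck (n := n)) := by
  constructor
  · intro s t h
    have h1 : wd s.1 = wd t.1 := congrArg (fun x => x.1.toList) h
    apply Subtype.ext
    have h2 := List.ofFn_injective h1
    funext l
    exact toStep_inj (congrFun h2 l)
  · rintro ⟨p, hp⟩
    have hlen : p.toList.length = 2 * n := by
      rw [← hp, DyckWord.two_mul_semilength_eq_length]
    let s : Fin (2 * n) → Bool := fun l => decide (p.toList[(l : ℕ)]'(by rw [hlen]; exact l.2) =
      DyckStep.U)
    have hwd : wd s = p.toList := by
      apply List.ext_getElem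
      · rw [wd_length, hlen]
      · intro i h1 h2
        simp only [wd, List.getElem_ofFn, s, toStep]
        rcases DyckStep.dichotomy (p.toList[i]) with h5 | h5 <;> simp [h5]
    have hs : IsDyck n s := by
      refine ⟨?_, ?_⟩
      · have h := wd_count s (2 * n) le_rfl
        rw [wd_take, hwd] at h
        rw [← h.1]
        exact hp
      · intro m hm
        have h := wd_count s m hm
        rw [hwd] at h
        have h2 := p.count_D_le_count_U m
        omega
    refine ⟨⟨s, hs⟩, ?_⟩
    apply Subtype.ext
    exact DyckWord.ext hwd

lemma card_dyck (n : ℕ) : Fintype.card {s : Fin (2 * n) → Bool // IsDyck n s} = catalan n := by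
  rw [← DyckWord.card_dyckWord_semilength_eq_catalan]
  exact Fintype.card_congr (Equiv.ofBijective _ toDyck_bij)

end Count

lemma isWheel_iff (n : ℕ) (p : MvPolynomial (Fin (2 * n)) ℂ) :
    IsWheel n p ↔ p.IsHomogeneous (n * (n - 1)) ∧ WheelOn Finset.univ p := by
  rw [wheelOn_iff]
  constructor
  · rintro ⟨h1, h2⟩
    refine ⟨h1, fun i _ j _ k _ hij hjk => ?_⟩
    rw [← h2 i j k hij hjk]
    unfold tri
    congr!
  · rintro ⟨h1, h2⟩
    refine ⟨h1, fun i j k hij hjk => ?_⟩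
    rw [← h2 i (Finset.mem_univ _) j (Finset.mem_univ _) k (Finset.mem_univ _) hij hjk]
    unfold tri
    congr!

/-- The subspace of wheel polynomials. -/
def wheelSpace (n : ℕ) : Submodule ℂ (MvPolynomial (Fin (2 * n)) ℂ) where
  carrier := {p | IsWheel n p}
  add_mem' := by
    rintro a b ⟨h1, h2⟩ ⟨h3, h4⟩
    refine ⟨h1.add h3, fun i j k hij hjk => ?_⟩
    rw [map_add, h2 i j k hij hjk, h4 i j k hij hjk, add_zero]
  zero_mem' := ⟨isHomogeneous_zero _ _ _, fun _ _ _ _ _ => map_zero _⟩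
  smul_mem' := by
    rintro c a ⟨h1, h2⟩
    refine ⟨(homogeneousSubmodule _ _ _).smul_mem c h1, fun i j k hij hjk => ?_⟩
    rw [map_smul, h2 i j k hij hjk, smul_zero]

/-- Evaluation at all Dyck points. -/
noncomputable def evMap (n : ℕ) :
    wheelSpace n →ₗ[ℂ] ({s : Fin (2 * n) → Bool // IsDyck n s} → ℂ) where
  toFun p s := eval (pt s.1) p.1
  map_add' a b := by
    funext s
    simp
  map_smul' c a := by
    funext s
    simp [smul_eval]

lemma evMap_injective (n : ℕ) : Function.Injective (evMap n) := by
  rw [← LinearMap.ker_eq_bot, LinearMap.ker_eq_bot']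
  rintro ⟨p, hp⟩ h
  apply Subtype.ext
  have hw := (isWheel_iff n p).1 hp
  refine evals_injective n Finset.univ p (fun _ => 0) (by simp) hw.2 hw.1.totalDegree_le ?_
  intro z _ hz
  obtain ⟨s, hs, rfl⟩ := dyckPt_univ hz
  exact congrFun h ⟨s, hs⟩

lemma pge_antisymm_upc {n : ℕ} {s t : Fin (2 * n) → Bool} (h1 : PGe s t) (h2 : PGe t s) :
    s = t := by
  funext l
  have e : ∀ m, upc s m = upc t m := fun m => le_antisymm (h2 m) (h1 m)
  have hs := upc_succ s l
  have ht := upc_succ t l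
  rw [e, e] at hs
  rw [hs] at ht
  cases h3 : s l <;> cases h4 : t l <;> simp [h3, h4] at ht ⊢

lemma wheel_lower (n : ℕ) : ∃ P : {s : Fin (2 * n) → Bool // IsDyck n s} → wheelSpace n,
    LinearIndependent ℂ P := by
  choose P hP using fun s : {s : Fin (2 * n) → Bool // IsDyck n s} => exists_good _ s.1 s.2 rfl
  refine ⟨fun s => ⟨P s, (isWheel_iff n _).2 ⟨(hP s).homog, (hP s).wheel⟩⟩, ?_⟩
  have hvan : ∀ s t : {s : Fin (2 * n) → Bool // IsDyck n s}, ¬ PGe t.1 s.1 →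
      eval (pt t.1) (P s) = 0 := by
    intro s t h
    obtain ⟨e, he, hpe⟩ := exists_match t.2
    rw [← hpe, eval_path, (hP s).van e he (by rw [hpe]; exact h), map_zero]
  rw [Fintype.linearIndependent_iff]
  intro g hg
  have hg' : ∀ t : {s : Fin (2 * n) → Bool // IsDyck n s},
      ∑ s, g s * eval (pt t.1) (P s) = 0 := by
    intro t
    have := congrFun (congrArg (evMap n) hg) t
    rw [map_sum, map_zero, Finset.sum_apply] at this
    simpa [evMap, smul_eval] using this
  -- strong induction on the sum of the counts
  have key : ∀ N : ℕ, ∀ t : {s : Fin (2 * n) → Bool // IsDyck n s},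
      ∑ m ∈ Finset.range (2 * n + 1), upc t.1 m = N → g t = 0 := by
    intro N
    induction N using Nat.strong_induction_on with
    | _ N ih =>
    intro t ht
    have h1 := hg' t
    rw [Finset.sum_eq_single t] at h1
    · exact (mul_eq_zero.1 h1).resolve_right (hP t).ne
    · intro s _ hst
      by_cases hge : PGe t.1 s.1
      · have hlt : ∑ m ∈ Finset.range (2 * n + 1), upc s.1 m < N := by
          rw [← ht]
          refine lt_of_le_of_ne (Finset.sum_le_sum fun m _ => hge m) ?_
          intro heq
          have h2 := (Finset.sum_eq_sum_iff_of_le fun m _ => hge m).1 heq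
          apply hst
          apply Subtype.ext
          refine pge_antisymm_upc (fun m => ?_) hge
          by_cases hm : m ≤ 2 * n
          · exact (h2 m (Finset.mem_range.2 (by omega))).ge
          · have h3 : ∀ u : Fin (2 * n) → Bool, upc u m = upc u (2 * n) := by
              intro u
              unfold upc
              congr 1
              ext x
              have := x.2
              simp only [Finset.mem_filter, Finset.mem_univ, true_and]
              constructor
              · rintro ⟨_, h⟩; exact ⟨by omega, h⟩
              · rintro ⟨_, h⟩; exact ⟨by omega, h⟩
            rw [h3, h3, s.2.1, t.2.1]
        rw [ih _ hlt s rfl, zero_mul]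
      · rw [hvan s t hge, mul_zero]
    · intro h
      exact absurd (Finset.mem_univ _) h
  exact fun t => key _ t rfl

/-- The wheel polynomials of order `n` form a subspace of dimension `Cat(n)`. -/
theorem wheel_space_dim (n : ℕ) (hn : 1 ≤ n) :
    ∃ W : Submodule ℂ (MvPolynomial (Fin (2 * n)) ℂ),
      (W : Set (MvPolynomial (Fin (2 * n)) ℂ)) = {p | IsWheel n p} ∧
      Module.finrank ℂ W = catalan n := by
  refine ⟨wheelSpace n, rfl, ?_⟩
  have : Module.Finite ℂ (wheelSpace n) := Module.Finite.of_injective _ (evMap_injective n)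
  apply le_antisymm
  · have h := LinearMap.finrank_le_finrank_of_injective (evMap_injective n)
    rwa [Module.finrank_fintype_fun_eq_card, card_dyck] at h
  · obtain ⟨P, hP⟩ := wheel_lower n
    have h := hP.fintype_card_le_finrank
    rwa [card_dyck] at h
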